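/- For the compound primitive relay channel with state set Q, the random code capacity is at most R_CS(Q) = inf_{q∈Q} max_{p(x)} min{ I_q(X;Y) + C_1, I_q(X;Y,Y_1) }. -/

import Mathlib

open scoped BigOperators ENNReal

noncomputable section

/-- `p` is a probability mass function on a finite type. -/
def IsPMF {α : Type} [Fintype α] (p : α → ℝ) : Prop :=
  (∀ a, 0 ≤ p a) ∧ ∑ a, p a = 1

/-- `W` is a channel: each `W x s` is a pmf on the output alphabet. -/
def IsChannel {𝒳 𝒮 𝒵 : Type} [Fintype 𝒵] (W : 𝒳 → 𝒮 → 𝒵 → ℝ) : Prop :=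
  ∀ x s, IsPMF (W x s)

/-- Shannon entropy (base 2). By the convention `log₂ 0 = 0` in Mathlib, terms with
`p a = 0` contribute `0`. -/
def ent {α : Type} [Fintype α] (p : α → ℝ) : ℝ :=
  -∑ a, p a * Real.logb 2 (p a)

/-- Mutual information of a joint pmf on a product of finite types. -/
def mutInfo {α β : Type} [Fintype α] [Fintype β] (p : α × β → ℝ) : ℝ :=
  ent (fun a => ∑ b, p (a, b)) + ent (fun b => ∑ a, p (a, b)) - ent p

/-- Conditional mutual information `I(X;Y|U)` of a joint pmf on `U × X × Y`,
via `I(X;Y|U) = H(U,X) + H(U,Y) − H(U,X,Y) − H(U)`. -/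
def condMutInfo {υ α β : Type} [Fintype υ] [Fintype α] [Fintype β]
    (p : υ × α × β → ℝ) : ℝ :=
  ent (fun ua : υ × α => ∑ b, p (ua.1, ua.2, b))
    + ent (fun ub : υ × β => ∑ a, p (ub.1, a, ub.2))
    - ent p
    - ent (fun u : υ => ∑ a, ∑ b, p (u, a, b))

section InfoQuantities

variable {𝒳 𝒮 𝒴 𝒴₁ : Type} [Fintype 𝒳] [Fintype 𝒮] [Fintype 𝒴] [Fintype 𝒴₁]

/-- `I_q(X;Y)` under input pmf `p(x)`, state pmf `q(s)` and channel `W`. -/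
def IqXY (W : 𝒳 → 𝒮 → 𝒴 × 𝒴₁ → ℝ) (p : 𝒳 → ℝ) (q : 𝒮 → ℝ) : ℝ :=
  mutInfo (fun xy : 𝒳 × 𝒴 => p xy.1 * ∑ s, q s * ∑ y1, W xy.1 s (xy.2, y1))

/-- `I_q(X;Y,Y₁)`. -/
def IqXYY1 (W : 𝒳 → 𝒮 → 𝒴 × 𝒴₁ → ℝ) (p : 𝒳 → ℝ) (q : 𝒮 → ℝ) : ℝ :=
  mutInfo (fun xz : 𝒳 × (𝒴 × 𝒴₁) => p xz.1 * ∑ s, q s * W xz.1 s xz.2)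

/-- `I_q(U;Y)` under input pmf `p(u,x)` (auxiliary alphabet `Fin k`). -/
def IqUY {k : ℕ} (W : 𝒳 → 𝒮 → 𝒴 × 𝒴₁ → ℝ) (p : Fin k × 𝒳 → ℝ) (q : 𝒮 → ℝ) : ℝ :=
  mutInfo (fun uy : Fin k × 𝒴 => ∑ x, ∑ s, ∑ y1, p (uy.1, x) * q s * W x s (uy.2, y1))

/-- `I_q(U;Y₁)` under input pmf `p(u,x)`. -/
def IqUY1 {k : ℕ} (W : 𝒳 → 𝒮 → 𝒴 × 𝒴₁ → ℝ) (p : Fin k × 𝒳 → ℝ) (q : 𝒮 → ℝ) : ℝ :=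
  mutInfo (fun uy : Fin k × 𝒴₁ => ∑ x, ∑ s, ∑ y, p (uy.1, x) * q s * W x s (y, uy.2))

/-- `I_q(X;Y|U)` under input pmf `p(u,x)`. -/
def IqXYgivenU {k : ℕ} (W : 𝒳 → 𝒮 → 𝒴 × 𝒴₁ → ℝ) (p : Fin k × 𝒳 → ℝ) (q : 𝒮 → ℝ) : ℝ :=
  condMutInfo (fun uxy : Fin k × 𝒳 × 𝒴 =>
    p (uxy.1, uxy.2.1) * ∑ s, q s * ∑ y1, W uxy.2.1 s (uxy.2.2, y1))

/-- The partial decode-forward lower bound `R_DF(Q)`: the supremum over all finite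
auxiliary alphabets (represented by `Fin k`) and input pmfs `p(u,x)` of
`min{ inf_q I_q(U;Y) + inf_q I_q(X;Y|U) + C₁, inf_q I_q(U;Y₁) + inf_q I_q(X;Y|U) }`. -/
def RDF (W : 𝒳 → 𝒮 → 𝒴 × 𝒴₁ → ℝ) (C1 : ℝ) (Q : Set (𝒮 → ℝ)) : ℝ :=
  sSup {r | ∃ (k : ℕ) (p : Fin k × 𝒳 → ℝ), IsPMF p ∧
    r = min
      (sInf {v | ∃ q ∈ Q, v = IqUY W p q} + sInf {v | ∃ q ∈ Q, v = IqXYgivenU W p q} + C1)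
      (sInf {v | ∃ q ∈ Q, v = IqUY1 W p q} + sInf {v | ∃ q ∈ Q, v = IqXYgivenU W p q})}

/-- The cutset upper bound
`R_CS(Q) = inf_{q∈Q} max_{p(x)} min{ I_q(X;Y) + C₁, I_q(X;Y,Y₁) }`. -/
def RCS (W : 𝒳 → 𝒮 → 𝒴 × 𝒴₁ → ℝ) (C1 : ℝ) (Q : Set (𝒮 → ℝ)) : ℝ :=
  sInf {r | ∃ q ∈ Q, r = sSup {v | ∃ p : 𝒳 → ℝ, IsPMF p ∧
    v = min (IqXY W p q + C1) (IqXYY1 W p q)}}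

end InfoQuantities

/-- A deterministic code for the primitive relay channel: a message encoder, a relay
function mapping the relay's received block to one of `L` indices sent over the
noiseless link, and a decoder using the channel output together with that index. -/
structure PCode (𝒳 𝒴 𝒴₁ : Type) (n M L : ℕ) where
  f : Fin M → Fin n → 𝒳
  f1 : (Fin n → 𝒴₁) → Fin L
  g : (Fin n → 𝒴) × Fin L → Fin M

/-- The noiseless link of rate `C₁` supports `L` indices when `L ≤ 2^{nC₁}`. -/
def LinkOK (n L : ℕ) (C1 : ℝ) : Prop := 1 ≤ L ∧ (L : ℝ) ≤ (2 : ℝ) ^ ((n : ℝ) * C1)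

section Codes

variable {𝒳 𝒮 𝒴 𝒴₁ : Type} [Fintype 𝒳] [Fintype 𝒮] [Fintype 𝒴] [Fintype 𝒴₁]
variable {n M L : ℕ}

/-- Conditional probability of error of the code given the state sequence `s`. -/
def PCode.errGiven (C : PCode 𝒳 𝒴 𝒴₁ n M L) (W : 𝒳 → 𝒮 → 𝒴 × 𝒴₁ → ℝ)
    (s : Fin n → 𝒮) : ℝ :=
  (M : ℝ)⁻¹ * ∑ m : Fin M, ∑ y : Fin n → 𝒴, ∑ y1 : Fin n → 𝒴₁,
    if C.g (y, C.f1 y1) = m then 0 else ∏ i, W (C.f m i) (s i) (y i, y1 i)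

/-- Average error probability under an i.i.d. state distribution `q`. -/
def PCode.errIID (C : PCode 𝒳 𝒴 𝒴₁ n M L) (W : 𝒳 → 𝒮 → 𝒴 × 𝒴₁ → ℝ)
    (q : 𝒮 → ℝ) : ℝ :=
  ∑ s : Fin n → 𝒮, (∏ i, q (s i)) * C.errGiven W s

/-- Average error probability under an arbitrary joint state distribution `qn`. -/
def PCode.errJoint (C : PCode 𝒳 𝒴 𝒴₁ n M L) (W : 𝒳 → 𝒮 → 𝒴 × 𝒴₁ → ℝ)
    (qn : (Fin n → 𝒮) → ℝ) : ℝ :=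
  ∑ s : Fin n → 𝒮, qn s * C.errGiven W s

end Codes

section Capacities

variable {𝒳 𝒮 𝒴 𝒴₁ : Type} [Fintype 𝒳] [Fintype 𝒮] [Fintype 𝒴] [Fintype 𝒴₁]

/-- `R` is achievable by deterministic codes over the compound primitive relay
channel with state set `Q`. -/
def CompAchievable (W : 𝒳 → 𝒮 → 𝒴 × 𝒴₁ → ℝ) (C1 : ℝ) (Q : Set (𝒮 → ℝ)) (R : ℝ) : Prop :=
  ∀ ε > (0 : ℝ), ∃ N : ℕ, ∀ n ≥ N, ∃ (M L : ℕ) (C : PCode 𝒳 𝒴 𝒴₁ n M L),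
    (2 : ℝ) ^ ((n : ℝ) * R) ≤ (M : ℝ) ∧ LinkOK n L C1 ∧
    ∀ q ∈ Q, C.errIID W q ≤ ε

/-- The deterministic code capacity of the compound primitive relay channel. -/
def CompCapacity (W : 𝒳 → 𝒮 → 𝒴 × 𝒴₁ → ℝ) (C1 : ℝ) (Q : Set (𝒮 → ℝ)) : ℝ :=
  sSup {R | CompAchievable W C1 Q R}

/-- `R` is achievable by random codes over the compound primitive relay channel. -/
def CompRandAchievable (W : 𝒳 → 𝒮 → 𝒴 × 𝒴₁ → ℝ) (C1 : ℝ) (Q : Set (𝒮 → ℝ)) (R : ℝ) :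
    Prop :=
  ∀ ε > (0 : ℝ), ∃ N : ℕ, ∀ n ≥ N, ∃ (M L : ℕ),
    (2 : ℝ) ^ ((n : ℝ) * R) ≤ (M : ℝ) ∧ LinkOK n L C1 ∧
    ∃ (J : Type) (π : PMF J) (Cs : J → PCode 𝒳 𝒴 𝒴₁ n M L),
      ∀ q ∈ Q, (∑' j, π j * ENNReal.ofReal ((Cs j).errIID W q)) ≤ ENNReal.ofReal ε

/-- The random code capacity of the compound primitive relay channel. -/
def CompRandCapacity (W : 𝒳 → 𝒮 → 𝒴 × 𝒴₁ → ℝ) (C1 : ℝ) (Q : Set (𝒮 → ℝ)) : ℝ :=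
  sSup {R | CompRandAchievable W C1 Q R}

/-- `R` is achievable by deterministic codes over the primitive AVRC: the average
error is small under every joint state distribution. -/
def AVRCAchievable (W : 𝒳 → 𝒮 → 𝒴 × 𝒴₁ → ℝ) (C1 R : ℝ) : Prop :=
  ∀ ε > (0 : ℝ), ∃ N : ℕ, ∀ n ≥ N, ∃ (M L : ℕ) (C : PCode 𝒳 𝒴 𝒴₁ n M L),
    (2 : ℝ) ^ ((n : ℝ) * R) ≤ (M : ℝ) ∧ LinkOK n L C1 ∧
    ∀ qn : (Fin n → 𝒮) → ℝ, IsPMF qn → C.errJoint W qn ≤ ε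

/-- The deterministic code capacity of the primitive AVRC. -/
def AVRCCapacity (W : 𝒳 → 𝒮 → 𝒴 × 𝒴₁ → ℝ) (C1 : ℝ) : ℝ :=
  sSup {R | AVRCAchievable W C1 R}

/-- `R` is achievable by random codes over the primitive AVRC. -/
def AVRCRandAchievable (W : 𝒳 → 𝒮 → 𝒴 × 𝒴₁ → ℝ) (C1 R : ℝ) : Prop :=
  ∀ ε > (0 : ℝ), ∃ N : ℕ, ∀ n ≥ N, ∃ (M L : ℕ),
    (2 : ℝ) ^ ((n : ℝ) * R) ≤ (M : ℝ) ∧ LinkOK n L C1 ∧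
    ∃ (J : Type) (π : PMF J) (Cs : J → PCode 𝒳 𝒴 𝒴₁ n M L),
      ∀ qn : (Fin n → 𝒮) → ℝ, IsPMF qn →
        (∑' j, π j * ENNReal.ofReal ((Cs j).errJoint W qn)) ≤ ENNReal.ofReal ε

/-- The random code capacity of the primitive AVRC. -/
def AVRCRandCapacity (W : 𝒳 → 𝒮 → 𝒴 × 𝒴₁ → ℝ) (C1 : ℝ) : ℝ :=
  sSup {R | AVRCRandAchievable W C1 R}

end Capacities

/-- The channel is reversely strongly degraded:
`W(y,y₁|x,s) = W_{Y|X,S}(y|x,s)·W_{Y₁|Y}(y₁|y)`. -/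
def RevStronglyDegraded {𝒳 𝒮 𝒴 𝒴₁ : Type} [Fintype 𝒴] [Fintype 𝒴₁]
    (W : 𝒳 → 𝒮 → 𝒴 × 𝒴₁ → ℝ) : Prop :=
  ∃ (WY : 𝒳 → 𝒮 → 𝒴 → ℝ) (V : 𝒴 → 𝒴₁ → ℝ),
    (∀ x s, IsPMF (WY x s)) ∧ (∀ y, IsPMF (V y)) ∧
    ∀ x s y y1, W x s (y, y1) = WY x s y * V y y1

/-- A state-dependent DMC `V(z|x,s)` is symmetrizable. -/
def Symmetrizable {𝒳 𝒮 𝒵 : Type} [Fintype 𝒮] (V : 𝒳 → 𝒮 → 𝒵 → ℝ) : Prop :=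
  ∃ J : 𝒳 → 𝒮 → ℝ, (∀ x, IsPMF (J x)) ∧
    ∀ x x' z, (∑ s, V x s z * J x' s) = ∑ s, V x' s z * J x s

open Finset in
/-- Independent coordinates marginalise: the expectation of a function of one coordinate under a
product of pmfs only involves the factor of that coordinate. -/
theorem sum_prod_mul_coord {ι α : Type} [Fintype ι] [DecidableEq ι] [Fintype α] (v : ι → α → ℝ)
    (hv : ∀ k, ∑ a, v k a = 1) (i : ι) (h : α → ℝ) :
    ∑ z : ι → α, (∏ k, v k (z k)) * h (z i) = ∑ a, v i a * h a := by
  have key := Finset.prod_univ_sum (fun _ : ι => (univ : Finset α))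
    (fun k a => v k a * (if k = i then h a else 1))
  rw [Fintype.piFinset_univ] at key
  have hfac : ∀ z : ι → α, ∏ k, v k (z k) * (if k = i then h (z k) else 1)
      = (∏ k, v k (z k)) * h (z i) := by
    intro z
    rw [prod_mul_distrib, prod_ite_eq' univ i (fun k => h (z k)), if_pos (mem_univ i)]
  rw [← sum_congr rfl (fun z _ => hfac z), ← key, prod_eq_single i]
  · simp
  · intro k _ hk
    simp [hk, hv]
  · simp

theorem sum_prod_eq_prod_sum {ι α : Type} [Fintype ι] [DecidableEq ι] [Fintype α]
    (v : ι → α → ℝ) : ∑ z : ι → α, ∏ k, v k (z k) = ∏ k, ∑ a, v k a := by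
  rw [Finset.prod_univ_sum, Fintype.piFinset_univ]

theorem IsPMF.le_one {α : Type} [Fintype α] {p : α → ℝ} (hp : IsPMF p) (a : α) : p a ≤ 1 :=
  hp.2 ▸ Finset.single_le_sum (fun b _ => hp.1 b) (Finset.mem_univ a)

theorem IsPMF.output {α β : Type} [Fintype α] [Fintype β] {p : α → ℝ} {V : α → β → ℝ}
    (hp : IsPMF p) (hV : ∀ x, IsPMF (V x)) : IsPMF (fun z => ∑ x, p x * V x z) := by
  refine ⟨fun z => Finset.sum_nonneg fun x _ => mul_nonneg (hp.1 x) ((hV x).1 z), ?_⟩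
  rw [Finset.sum_comm, ← hp.2]
  exact Finset.sum_congr rfl fun x _ => by rw [← Finset.mul_sum, (hV x).2, mul_one]

theorem IsPMF.ent_nonneg {α : Type} [Fintype α] {p : α → ℝ} (hp : IsPMF p) : 0 ≤ ent p := by
  rw [ent, neg_nonneg]
  exact Finset.sum_nonpos fun a _ => mul_nonpos_of_nonneg_of_nonpos (hp.1 a)
    (Real.logb_nonpos one_lt_two (hp.1 a) (hp.le_one a))

theorem IsPMF.ent_le {α : Type} [Fintype α] {p : α → ℝ} (hp : IsPMF p) :
    ent p ≤ Fintype.card α * (Real.log 2)⁻¹ := by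
  have h2 : 0 < Real.log 2 := Real.log_pos one_lt_two
  rw [ent, ← Finset.sum_neg_distrib]
  refine (Finset.sum_le_card_nsmul _ _ (Real.log 2)⁻¹ fun a _ => ?_).trans_eq (by simp)
  have hlog : -(p a * Real.log (p a)) ≤ 1 := by
    rcases (hp.1 a).eq_or_lt with h | h
    · simp [← h]
    · have := (abs_lt.1 (Real.abs_log_mul_self_lt (p a) h (hp.le_one a))).1
      linarith [mul_comm (p a) (Real.log (p a))]
  calc -(p a * Real.logb 2 (p a)) = -(p a * Real.log (p a)) * (Real.log 2)⁻¹ := by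
        rw [Real.logb]; ring
    _ ≤ 1 * (Real.log 2)⁻¹ := by gcongr
    _ = _ := one_mul _

theorem IsPMF.joint {α β : Type} [Fintype α] [Fintype β] {p : α → ℝ} {V : α → β → ℝ}
    (hp : IsPMF p) (hV : ∀ x, IsPMF (V x)) : IsPMF (fun xz : α × β => p xz.1 * V xz.1 xz.2) := by
  refine ⟨fun xz => mul_nonneg (hp.1 _) ((hV _).1 _), ?_⟩
  rw [Fintype.sum_prod_type, ← hp.2]
  exact Finset.sum_congr rfl fun x _ => by simp only [← Finset.mul_sum, (hV x).2, mul_one]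

theorem sum_mul_channel {α β : Type} [Fintype β] (p : α → ℝ) {V : α → β → ℝ} [Fintype α]
    (hV : ∀ x, IsPMF (V x)) : (fun x => ∑ z, p x * V x z) = p := by
  funext x
  rw [← Finset.mul_sum, (hV x).2, mul_one]

theorem mutInfo_le {α β : Type} [Fintype α] [Fintype β] {p : α → ℝ} {V : α → β → ℝ}
    (hp : IsPMF p) (hV : ∀ x, IsPMF (V x)) :
    mutInfo (fun xz : α × β => p xz.1 * V xz.1 xz.2)
      ≤ Fintype.card α * (Real.log 2)⁻¹ + Fintype.card β * (Real.log 2)⁻¹ := by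
  have h1 := hp.ent_le
  have h2 := (hp.output hV).ent_le
  have h3 := (hp.joint hV).ent_nonneg
  simp only [mutInfo, sum_mul_channel p hV]
  linarith

/-- Mutual information as an averaged divergence from the output distribution. -/
theorem mutInfo_eq_sum_logb {α β : Type} [Fintype α] [Fintype β] {p : α → ℝ} {V : α → β → ℝ}
    (hp : IsPMF p) (hV : ∀ x, IsPMF (V x)) :
    mutInfo (fun xz : α × β => p xz.1 * V xz.1 xz.2)
      = ∑ x, p x * ∑ z, V x z * Real.logb 2 (V x z / ∑ x', p x' * V x' z) := by
  have e1 : ∑ x, p x * Real.logb 2 (p x) = ∑ x, ∑ z, p x * V x z * Real.logb 2 (p x) :=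
    Finset.sum_congr rfl fun x _ => by rw [← Finset.sum_mul, ← Finset.mul_sum, (hV x).2, mul_one]
  have e2 : ∑ z, (∑ x, p x * V x z) * Real.logb 2 (∑ x, p x * V x z)
      = ∑ x, ∑ z, p x * V x z * Real.logb 2 (∑ x', p x' * V x' z) := by
    rw [Finset.sum_comm]
    exact Finset.sum_congr rfl fun z _ => by rw [← Finset.sum_mul]
  simp only [mutInfo, sum_mul_channel p hV]
  simp only [ent, Fintype.sum_prod_type, e1, e2]
  rw [← neg_add, sub_neg_eq_add, neg_add_eq_sub, ← Finset.sum_add_distrib,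
    ← Finset.sum_sub_distrib]
  refine Finset.sum_congr rfl fun x _ => ?_
  rw [← Finset.sum_add_distrib, ← Finset.sum_sub_distrib, Finset.mul_sum]
  refine Finset.sum_congr rfl fun z _ => ?_
  by_cases hx : p x = 0
  · simp [hx]
  by_cases hz : V x z = 0
  · simp [hz]
  have hpos : 0 < ∑ x', p x' * V x' z := by
    have hterm : 0 < p x * V x z :=
      mul_pos ((hp.1 x).lt_of_ne' hx) (((hV x).1 z).lt_of_ne' hz)
    exact hterm.trans_le (Finset.single_le_sum
      (f := fun x' => p x' * V x' z)
      (fun x' _ => mul_nonneg (hp.1 x') ((hV x').1 z)) (Finset.mem_univ x))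
  rw [Real.logb_mul hx hz, Real.logb_div hz hpos.ne']
  ring

/-- A Donsker–Varadhan type bound: a weight of mean at most `2` under `Q` has expected
log-weight under `P` at most one bit above the divergence of `P` from `Q`. -/
theorem sum_mul_logb_sub_one_le {Ω : Type} [Fintype Ω] {P Q w : Ω → ℝ} (hP : IsPMF P)
    (hQ : ∀ a, 0 ≤ Q a) (hPQ : ∀ a, P a ≠ 0 → Q a ≠ 0) (hw : ∀ a, 0 < w a)
    (hsum : ∑ a, Q a * w a ≤ 2) :
    ∑ a, P a * Real.logb 2 (w a) - 1 ≤ ∑ a, P a * Real.logb 2 (P a / Q a) := by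
  have h2 : 0 < Real.log 2 := Real.log_pos one_lt_two
  have hpt : ∀ a, P a * Real.log (w a) - P a * Real.log (P a / Q a)
      ≤ Q a * w a / 2 - P a + P a * Real.log 2 := by
    intro a
    by_cases ha : P a = 0
    · have := mul_nonneg (hQ a) (hw a).le
      simp only [ha, zero_mul, sub_zero, add_zero]
      positivity
    have hPa := (hP.1 a).lt_of_ne' ha
    have hQa := (hQ a).lt_of_ne' (hPQ a ha)
    have hlog := Real.log_le_sub_one_of_pos (x := Q a * w a / (2 * P a))
      (by have := hw a; positivity)
    rw [Real.log_div (mul_pos hQa (hw a)).ne' (by positivity),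
      Real.log_mul hQa.ne' (hw a).ne', Real.log_mul two_ne_zero ha] at hlog
    rw [Real.log_div ha hQa.ne']
    have := mul_le_mul_of_nonneg_left hlog hPa.le
    have hcancel : P a * (Q a * w a / (2 * P a) - 1) = Q a * w a / 2 - P a := by
      field_simp
    rw [hcancel] at this
    linarith
  have htot := Finset.sum_le_sum fun a (_ : a ∈ Finset.univ) => hpt a
  rw [Finset.sum_sub_distrib, Finset.sum_add_distrib, Finset.sum_sub_distrib, ← Finset.sum_div,
    ← Finset.sum_mul, hP.2] at htot
  simp only [Real.logb, ← mul_div_assoc, ← Finset.sum_div]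
  rw [sub_le_iff_le_add, div_le_iff₀ h2, add_mul, div_mul_cancel₀ _ h2.ne']
  linarith

section CodeConverse

variable {α β : Type} [Fintype α] [Fintype β] {M n : ℕ}

/-- The distribution of a uniformly chosen letter of a uniformly chosen codeword. -/
def letterPMF (f : Fin M → Fin n → α) (x : α) : ℝ :=
  open Classical in (M : ℝ)⁻¹ * ∑ m, (n : ℝ)⁻¹ * ∑ i, if f m i = x then 1 else 0

theorem sum_letterPMF_mul (f : Fin M → Fin n → α) (h : α → ℝ) :
    ∑ x, letterPMF f x * h x = (M : ℝ)⁻¹ * ∑ m, (n : ℝ)⁻¹ * ∑ i, h (f m i) := by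
  classical
  have hterm : ∀ x, letterPMF f x * h x
      = (M : ℝ)⁻¹ * ∑ m, (n : ℝ)⁻¹ * ∑ i, if f m i = x then h x else 0 := fun x => by
    simp only [letterPMF, mul_assoc, Finset.sum_mul, ite_mul, one_mul, zero_mul]
  rw [Finset.sum_congr rfl fun x _ => hterm x, ← Finset.mul_sum, Finset.sum_comm]
  congr 1
  refine Finset.sum_congr rfl fun m _ => ?_
  rw [← Finset.mul_sum, Finset.sum_comm]
  simp

theorem isPMF_letterPMF (hM : 0 < M) (hn : 0 < n) (f : Fin M → Fin n → α) :
    IsPMF (letterPMF f) := by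
  constructor
  · intro x
    unfold letterPMF
    positivity
  · have h := sum_letterPMF_mul f (fun _ => 1)
    have hM' : (M : ℝ) ≠ 0 := by positivity
    have hn' : (n : ℝ) ≠ 0 := by positivity
    simpa [hM', hn'] using h

omit [Fintype α] in
theorem letterPMF_pos (hM : 0 < M) (hn : 0 < n) (f : Fin M → Fin n → α) (m : Fin M)
    (i : Fin n) : 0 < letterPMF f (f m i) := by
  classical
  unfold letterPMF
  refine mul_pos (by positivity) (Finset.sum_pos' (fun _ _ => by positivity)
    ⟨m, Finset.mem_univ m, mul_pos (by positivity) (Finset.sum_pos' (fun _ _ => by positivity)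
      ⟨i, Finset.mem_univ i, by simp⟩)⟩)

open Classical in
/-- Average error probability of list decoding with decoding regions `A m`. -/
def listErr (V : α → β → ℝ) (f : Fin M → Fin n → α) (A : Fin M → Set (Fin n → β)) : ℝ :=
  (M : ℝ)⁻¹ * ∑ m, ∑ z : Fin n → β, if z ∈ A m then 0 else ∏ i, V (f m i) (z i)

omit [Fintype α] in
theorem listErr_nonneg {V : α → β → ℝ} (hV : ∀ x, IsPMF (V x)) (f : Fin M → Fin n → α)
    (A : Fin M → Set (Fin n → β)) : 0 ≤ listErr V f A := by
  refine mul_nonneg (by positivity) (Finset.sum_nonneg fun m _ => Finset.sum_nonneg fun z _ => ?_)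
  split_ifs
  · exact le_rfl
  · exact Finset.prod_nonneg fun i _ => (hV _).1 _

omit [Fintype α] in
/-- The joint distribution of a uniform message and the channel output block. -/
theorem isPMF_codeJoint {V : α → β → ℝ} (hV : ∀ x, IsPMF (V x)) (hM : 0 < M)
    (f : Fin M → Fin n → α) :
    IsPMF (fun a : Fin M × (Fin n → β) => (M : ℝ)⁻¹ * ∏ i, V (f a.1 i) (a.2 i)) := by
  refine ⟨fun a => mul_nonneg (by positivity) (Finset.prod_nonneg fun i _ => (hV _).1 _), ?_⟩
  have hM' : (M : ℝ) ≠ 0 := by positivity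
  rw [← Finset.mul_sum, Fintype.sum_prod_type]
  have hone : ∀ m, ∑ z : Fin n → β, ∏ i, V (f m i) (z i) = 1 := fun m => by
    simp [sum_prod_eq_prod_sum (fun i b => V (f m i) b), (hV _).2]
  simp [hone, hM']

theorem sum_codeJoint_mul_logb {V : α → β → ℝ} (hV : ∀ x, IsPMF (V x)) (hM : 0 < M) (hn : 0 < n)
    (f : Fin M → Fin n → α) :
    ∑ a : Fin M × (Fin n → β), (M : ℝ)⁻¹ * (∏ i, V (f a.1 i) (a.2 i)) *
        Real.logb 2 ((M : ℝ)⁻¹ * (∏ i, V (f a.1 i) (a.2 i)) /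
          ((M : ℝ)⁻¹ * ∏ i, ∑ x, letterPMF f x * V x (a.2 i)))
      = n * mutInfo (fun xz : α × β => letterPMF f xz.1 * V xz.1 xz.2) := by
  have hp := isPMF_letterPMF hM hn f
  have hM' : (M : ℝ) ≠ 0 := by positivity
  have hn' : (n : ℝ) ≠ 0 := by positivity
  set r : β → ℝ := fun z => ∑ x, letterPMF f x * V x z with hr
  rw [mutInfo_eq_sum_logb hp hV, sum_letterPMF_mul, Fintype.sum_prod_type, ← Finset.mul_sum,
    mul_left_comm, mul_inv_cancel_left₀ hn', Finset.mul_sum]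
  refine Finset.sum_congr rfl fun m _ => ?_
  simp only [mul_assoc, ← Finset.mul_sum]
  congr 1
  rw [← Finset.sum_congr rfl fun i _ => sum_prod_mul_coord (fun k b => V (f m k) b)
    (fun k => (hV _).2) i (fun b => Real.logb 2 (V (f m i) b / r b)), Finset.sum_comm]
  refine Finset.sum_congr rfl fun z _ => ?_
  rw [← Finset.mul_sum]
  by_cases h0 : ∏ i, V (f m i) (z i) = 0
  · simp [h0]
  have hne : ∀ i ∈ Finset.univ, V (f m i) (z i) ≠ 0 := Finset.prod_ne_zero_iff.1 h0
  have hrne : ∀ i, r (z i) ≠ 0 := fun i => by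
    have hterm : 0 < letterPMF f (f m i) * V (f m i) (z i) :=
      mul_pos (letterPMF_pos hM hn f m i) (((hV _).1 _).lt_of_ne' (hne i (Finset.mem_univ i)))
    exact (hterm.trans_le (Finset.single_le_sum (f := fun x' => letterPMF f x' * V x' (z i))
      (fun x' _ => mul_nonneg (hp.1 x') ((hV x').1 _)) (Finset.mem_univ (f m i)))).ne'
  rw [mul_div_mul_left _ _ (inv_ne_zero hM'), ← Finset.prod_div_distrib,
    Real.logb_prod _ _ fun i hi => div_ne_zero (hne i hi) (hrne i)]

/-- Converse for list decoding with lists of size at most `L` over a memoryless channel. -/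
theorem list_decoding_converse {V : α → β → ℝ} (hV : ∀ x, IsPMF (V x)) {L : ℕ} (hM : 0 < M)
    (hn : 0 < n) (hL : 0 < L) (f : Fin M → Fin n → α) (A : Fin M → Set (Fin n → β))
    (hA : ∀ z, {m | z ∈ A m}.ncard ≤ L) :
    (1 - listErr V f A) * Real.logb 2 (M / L) - 1
      ≤ n * mutInfo (fun xz : α × β => letterPMF f xz.1 * V xz.1 xz.2) := by
  classical
  have hp := isPMF_letterPMF hM hn f
  have hM' : (0 : ℝ) < M := by positivity
  have hL' : (0 : ℝ) < L := by positivity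
  have hr := hp.output hV
  have hP := isPMF_codeJoint (n := n) hV hM f
  have key := sum_mul_logb_sub_one_le hP
    (Q := fun a => (M : ℝ)⁻¹ * ∏ i, ∑ x, letterPMF f x * V x (a.2 i))
    (w := fun a => if a.2 ∈ A a.1 then (M : ℝ) / L else 1)
    (fun a => mul_nonneg (by positivity) (Finset.prod_nonneg fun i _ => hr.1 _))
    (fun a ha => ?_) (fun a => by split_ifs <;> positivity) ?_
  · rw [sum_codeJoint_mul_logb hV hM hn f] at key
    refine le_trans (le_of_eq ?_) key
    congr 1
    have hsplit : 1 - listErr V f A = ∑ a : Fin M × (Fin n → β),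
        (M : ℝ)⁻¹ * (if a.2 ∈ A a.1 then ∏ i, V (f a.1 i) (a.2 i) else 0) := by
      rw [← hP.2, listErr, Fintype.sum_prod_type, Fintype.sum_prod_type, Finset.mul_sum,
        ← Finset.sum_sub_distrib]
      refine Finset.sum_congr rfl fun m _ => ?_
      rw [Finset.mul_sum, ← Finset.sum_sub_distrib]
      refine Finset.sum_congr rfl fun z _ => ?_
      dsimp only
      split_ifs <;> simp
    rw [hsplit, Finset.sum_mul]
    refine Finset.sum_congr rfl fun a _ => ?_
    split_ifs <;> simp
  · refine mul_ne_zero (inv_ne_zero hM'.ne') (Finset.prod_ne_zero_iff.2 fun i _ => ?_)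
    have hne : V (f a.1 i) (a.2 i) ≠ 0 :=
      Finset.prod_ne_zero_iff.1 (right_ne_zero_of_mul ha) i (Finset.mem_univ i)
    have hterm : 0 < letterPMF f (f a.1 i) * V (f a.1 i) (a.2 i) :=
      mul_pos (letterPMF_pos hM hn f a.1 i) (((hV _).1 _).lt_of_ne' hne)
    exact (hterm.trans_le (Finset.single_le_sum (f := fun x' => letterPMF f x' * V x' (a.2 i))
      (fun x' _ => mul_nonneg (hp.1 x') ((hV x').1 _)) (Finset.mem_univ (f a.1 i)))).ne'
  · have hlist : ∀ z : Fin n → β, ∑ m, (if z ∈ A m then (M : ℝ) / L else 1) ≤ 2 * M := by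
      intro z
      have hcard : ((Finset.univ.filter fun m => z ∈ A m).card : ℝ) ≤ L := by
        have := hA z
        rw [Set.ncard_eq_toFinset_card'] at this
        exact_mod_cast (by simpa using this)
      calc ∑ m, (if z ∈ A m then (M : ℝ) / L else 1)
          ≤ ∑ m : Fin M, ((if z ∈ A m then (M : ℝ) / L else 0) + 1) :=
            Finset.sum_le_sum fun m _ => by split_ifs <;> simp
        _ = (Finset.univ.filter fun m => z ∈ A m).card * ((M : ℝ) / L) + M := by
            simp [Finset.sum_add_distrib, ← Finset.sum_filter]
        _ ≤ L * ((M : ℝ) / L) + M := by gcongr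
        _ = 2 * M := by field_simp; ring
    rw [Fintype.sum_prod_type, Finset.sum_comm]
    simp only [mul_assoc]
    calc (∑ z : Fin n → β, ∑ m, (M : ℝ)⁻¹ * ((∏ i, ∑ x, letterPMF f x * V x (z i)) *
          (if z ∈ A m then (M : ℝ) / L else 1)))
        ≤ ∑ z : Fin n → β, (∏ i, ∑ x, letterPMF f x * V x (z i)) * 2 := by
          refine Finset.sum_le_sum fun z _ => ?_
          rw [← Finset.mul_sum, ← Finset.mul_sum, mul_left_comm]
          refine mul_le_mul_of_nonneg_left ?_ (Finset.prod_nonneg fun i _ => hr.1 _)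
          rw [inv_mul_le_iff₀ hM', mul_comm]
          exact hlist z
      _ = 2 := by
          rw [← Finset.sum_mul,
            sum_prod_eq_prod_sum (fun (_ : Fin n) b => ∑ x, letterPMF f x * V x b)]
          simp [hr.2]

/-- Rate form of the list decoding converse. -/
theorem rate_sub_le_mutInfo {V : α → β → ℝ} (hV : ∀ x, IsPMF (V x)) {L : ℕ} (hM : 0 < M)
    (hn : 0 < n) (hL : 0 < L) (f : Fin M → Fin n → α) (A : Fin M → Set (Fin n → β))
    (hA : ∀ z, {m | z ∈ A m}.ncard ≤ L) {R C ε : ℝ} (hMR : (2 : ℝ) ^ (n * R) ≤ M)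
    (hLC : (L : ℝ) ≤ (2 : ℝ) ^ (n * C)) (herr : listErr V f A ≤ ε) (hε : ε ≤ 1) :
    R - C - ε * |R - C| - (n : ℝ)⁻¹
      ≤ mutInfo (fun xz : α × β => letterPMF f xz.1 * V xz.1 xz.2) := by
  have hn' : (0 : ℝ) < n := by positivity
  have hL' : (0 : ℝ) < L := by positivity
  have hM' : (0 : ℝ) < M := by positivity
  have hconv := list_decoding_converse hV hM hn hL f A hA
  have h0 := listErr_nonneg hV f A
  have hlogM : n * R ≤ Real.logb 2 M := (Real.le_logb_iff_rpow_le one_lt_two hM').2 hMR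
  have hlogL : Real.logb 2 L ≤ n * C := (Real.logb_le_iff_le_rpow one_lt_two hL').2 hLC
  rw [Real.logb_div hM'.ne' hL'.ne'] at hconv
  have hmono : (1 - listErr V f A) * (n * (R - C))
      ≤ (1 - listErr V f A) * (Real.logb 2 M - Real.logb 2 L) :=
    mul_le_mul_of_nonneg_left (by linarith) (by linarith)
  have habs : listErr V f A * (R - C) ≤ ε * |R - C| :=
    (mul_le_mul_of_nonneg_left (le_abs_self _) h0).trans
      (mul_le_mul_of_nonneg_right herr (abs_nonneg _))
  have hscaled := mul_le_mul_of_nonneg_left habs hn'.le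
  refine le_of_mul_le_mul_left ?_ hn'
  have : (n : ℝ) * (n : ℝ)⁻¹ = 1 := mul_inv_cancel₀ hn'.ne'
  linarith

end CodeConverse

section Relay

variable {𝒳 𝒮 𝒴 𝒴₁ : Type} [Fintype 𝒳] [Fintype 𝒮] [Fintype 𝒴] [Fintype 𝒴₁] {n M L : ℕ}

/-- The channel averaged over the state distribution `q`. -/
def avgChannel {𝒵 : Type} (W : 𝒳 → 𝒮 → 𝒵 → ℝ) (q : 𝒮 → ℝ) (x : 𝒳) (z : 𝒵) : ℝ :=
  ∑ s, q s * W x s z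

omit [Fintype 𝒳] in
theorem isPMF_avgChannel {𝒵 : Type} [Fintype 𝒵] {W : 𝒳 → 𝒮 → 𝒵 → ℝ} (hW : IsChannel W)
    {q : 𝒮 → ℝ} (hq : IsPMF q) (x : 𝒳) : IsPMF (avgChannel W q x) :=
  hq.output (hW x)

omit [Fintype 𝒳] [Fintype 𝒮] in
theorem isChannel_marginal {W : 𝒳 → 𝒮 → 𝒴 × 𝒴₁ → ℝ} (hW : IsChannel W) :
    IsChannel (fun x s y => ∑ y1, W x s (y, y1)) := fun x s =>
  ⟨fun _ => Finset.sum_nonneg fun _ _ => (hW x s).1 _, by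
    rw [← Fintype.sum_prod_type]; exact (hW x s).2⟩

omit [Fintype 𝒳] [Fintype 𝒴] in
theorem avgChannel_marginal (W : 𝒳 → 𝒮 → 𝒴 × 𝒴₁ → ℝ) (q : 𝒮 → ℝ) (x : 𝒳) (y : 𝒴) :
    avgChannel (fun x s y => ∑ y1, W x s (y, y1)) q x y = ∑ y1, avgChannel W q x (y, y1) := by
  simp only [avgChannel, Finset.mul_sum]
  exact Finset.sum_comm

omit [Fintype 𝒳] in
/-- Under i.i.d. states the code operates over the averaged memoryless channel. -/
theorem PCode.errIID_eq (C : PCode 𝒳 𝒴 𝒴₁ n M L) (W : 𝒳 → 𝒮 → 𝒴 × 𝒴₁ → ℝ) (q : 𝒮 → ℝ) :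
    C.errIID W q = (M : ℝ)⁻¹ * ∑ m : Fin M, ∑ y : Fin n → 𝒴, ∑ y1 : Fin n → 𝒴₁,
      if C.g (y, C.f1 y1) = m then 0 else ∏ i, avgChannel W q (C.f m i) (y i, y1 i) := by
  simp only [PCode.errIID, PCode.errGiven, mul_left_comm _ (M : ℝ)⁻¹, ← Finset.mul_sum]
  congr 1
  simp only [Finset.mul_sum]
  rw [Finset.sum_comm]
  refine Finset.sum_congr rfl fun m _ => ?_
  rw [Finset.sum_comm]
  refine Finset.sum_congr rfl fun y _ => ?_
  rw [Finset.sum_comm]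
  refine Finset.sum_congr rfl fun y1 _ => ?_
  split_ifs
  · simp
  · simp only [avgChannel, ← sum_prod_eq_prod_sum
      (fun i s => q s * W (C.f m i) s (y i, y1 i)), Finset.prod_mul_distrib]

omit [Fintype 𝒳] in
theorem PCode.errIID_nonneg (C : PCode 𝒳 𝒴 𝒴₁ n M L) {W : 𝒳 → 𝒮 → 𝒴 × 𝒴₁ → ℝ}
    (hW : IsChannel W) {q : 𝒮 → ℝ} (hq : IsPMF q) : 0 ≤ C.errIID W q := by
  rw [C.errIID_eq]
  refine mul_nonneg (by positivity) (Finset.sum_nonneg fun m _ => Finset.sum_nonneg fun y _ =>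
    Finset.sum_nonneg fun y1 _ => ?_)
  split_ifs
  · exact le_rfl
  · exact Finset.prod_nonneg fun i _ => (isPMF_avgChannel hW hq _).1 _

omit [Fintype 𝒳] in
theorem PCode.listErr_joint (C : PCode 𝒳 𝒴 𝒴₁ n M L) (W : 𝒳 → 𝒮 → 𝒴 × 𝒴₁ → ℝ) (q : 𝒮 → ℝ) :
    listErr (avgChannel W q) C.f
        (fun m => {z | C.g (fun i => (z i).1, C.f1 fun i => (z i).2) = m})
      = C.errIID W q := by
  classical
  rw [C.errIID_eq, listErr]
  congr 1
  refine Finset.sum_congr rfl fun m _ => ?_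
  rw [← Fintype.sum_prod_type', ← (Equiv.arrowProdEquivProdArrow (Fin n) (fun _ => 𝒴)
    (fun _ => 𝒴₁)).sum_comp]
  refine Finset.sum_congr rfl fun z _ => ?_
  simp [Equiv.arrowProdEquivProdArrow]

omit [Fintype 𝒳] in
theorem PCode.listErr_marginal_le (C : PCode 𝒳 𝒴 𝒴₁ n M L) {W : 𝒳 → 𝒮 → 𝒴 × 𝒴₁ → ℝ}
    (hW : IsChannel W) {q : 𝒮 → ℝ} (hq : IsPMF q) :
    listErr (avgChannel (fun x s y => ∑ y1, W x s (y, y1)) q) C.f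
        (fun m => {y | ∃ j, C.g (y, j) = m})
      ≤ C.errIID W q := by
  classical
  rw [C.errIID_eq, listErr]
  refine mul_le_mul_of_nonneg_left (Finset.sum_le_sum fun m _ => Finset.sum_le_sum fun y _ => ?_)
    (by positivity)
  have hnn : ∀ y1 : Fin n → 𝒴₁, 0 ≤ ∏ i, avgChannel W q (C.f m i) (y i, y1 i) := fun y1 =>
    Finset.prod_nonneg fun i _ => (isPMF_avgChannel hW hq _).1 _
  split_ifs with h
  · exact Finset.sum_nonneg fun y1 _ => by split_ifs <;> simp [hnn]
  · simp only [avgChannel_marginal]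
    rw [← sum_prod_eq_prod_sum (fun i b => avgChannel W q (C.f m i) (y i, b))]
    refine Finset.sum_le_sum fun y1 _ => ?_
    rw [if_neg fun hg => h ⟨_, hg⟩]

theorem bddAbove_cutset {W : 𝒳 → 𝒮 → 𝒴 × 𝒴₁ → ℝ} (hW : IsChannel W) (C1 : ℝ) {q : 𝒮 → ℝ}
    (hq : IsPMF q) : BddAbove {v | ∃ p : 𝒳 → ℝ, IsPMF p ∧
      v = min (IqXY W p q + C1) (IqXYY1 W p q)} := by
  refine ⟨Fintype.card 𝒳 * (Real.log 2)⁻¹ + Fintype.card (𝒴 × 𝒴₁) * (Real.log 2)⁻¹, ?_⟩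
  rintro v ⟨p, hp, rfl⟩
  exact (min_le_right _ _).trans
    (mutInfo_le (V := avgChannel W q) hp (isPMF_avgChannel hW hq))

/-- Cutset converse for a single code under a fixed i.i.d. state distribution. -/
theorem PCode.rate_le_cutset (C : PCode 𝒳 𝒴 𝒴₁ n M L) {W : 𝒳 → 𝒮 → 𝒴 × 𝒴₁ → ℝ}
    (hW : IsChannel W) {q : 𝒮 → ℝ} (hq : IsPMF q) {C1 R ε : ℝ} (hn : 0 < n)
    (hMR : (2 : ℝ) ^ (n * R) ≤ M) (hL : LinkOK n L C1) (herr : C.errIID W q ≤ ε) (hε : ε ≤ 1) :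
    R - ε * (|R| + |R - C1|) - (n : ℝ)⁻¹ ≤ sSup {v | ∃ p : 𝒳 → ℝ, IsPMF p ∧
      v = min (IqXY W p q + C1) (IqXYY1 W p q)} := by
  have hM : 0 < M := by
    have : (0 : ℝ) < M := lt_of_lt_of_le (by positivity) hMR
    exact_mod_cast this
  have hε0 : 0 ≤ ε := (C.errIID_nonneg hW hq).trans herr
  refine le_trans ?_ (le_csSup (bddAbove_cutset hW C1 hq)
    ⟨letterPMF C.f, isPMF_letterPMF hM hn C.f, rfl⟩)
  have hbroadcast := rate_sub_le_mutInfo (isPMF_avgChannel hW hq) (L := 1) hM hn one_pos C.f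
    (fun m => {z | C.g (fun i => (z i).1, C.f1 fun i => (z i).2) = m}) (C := 0)
    (fun z => by simp) hMR (by simp) ((C.listErr_joint W q).trans_le herr) hε
  have hmultiple := rate_sub_le_mutInfo (isPMF_avgChannel (isChannel_marginal hW) hq) hM hn hL.1
    C.f (fun m => {y | ∃ j, C.g (y, j) = m}) (fun y => by
      have hrange : {m | y ∈ {y | ∃ j, C.g (y, j) = m}} = (fun j => C.g (y, j)) '' Set.univ := by
        ext m; simp
      rw [hrange]
      exact (Set.ncard_image_le Set.finite_univ).trans (by simp [Set.ncard_univ]))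
    hMR hL.2 ((C.listErr_marginal_le hW hq).trans herr) hε
  rw [sub_zero] at hbroadcast
  have h1 := mul_nonneg hε0 (abs_nonneg R)
  have h2 := mul_nonneg hε0 (abs_nonneg (R - C1))
  refine le_min ?_ ?_
  · change _ ≤ mutInfo (fun xz : 𝒳 × 𝒴 => letterPMF C.f xz.1 *
      avgChannel (fun x s y => ∑ y1, W x s (y, y1)) q xz.1 xz.2) + C1
    linarith
  · change _ ≤ mutInfo (fun xz : 𝒳 × (𝒴 × 𝒴₁) => letterPMF C.f xz.1 * avgChannel W q xz.1 xz.2)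
    linarith

/-- A small average over a random code forces some code in the ensemble to be good. -/
theorem exists_le_two_mul_of_tsum_le {J : Type} (π : PMF J) (e : J → ℝ) {ε : ℝ} (hε : 0 < ε)
    (h : ∑' j, π j * ENNReal.ofReal (e j) ≤ ENNReal.ofReal ε) : ∃ j, e j ≤ 2 * ε := by
  by_contra! hlt
  have hge : ENNReal.ofReal (2 * ε) ≤ ∑' j, π j * ENNReal.ofReal (e j) := by
    calc ENNReal.ofReal (2 * ε) = ∑' j, π j * ENNReal.ofReal (2 * ε) := by
          rw [ENNReal.tsum_mul_right, π.tsum_coe, one_mul]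
      _ ≤ _ := ENNReal.tsum_le_tsum fun j => by gcongr; exact (hlt j).le
  have := (ENNReal.ofReal_le_ofReal_iff hε.le).1 (hge.trans h)
  linarith

omit [Fintype 𝒳] in
theorem compRandAchievable_zero [Nonempty 𝒳] (W : 𝒳 → 𝒮 → 𝒴 × 𝒴₁ → ℝ) {C1 : ℝ} (hC1 : 0 ≤ C1)
    (Q : Set (𝒮 → ℝ)) : CompRandAchievable W C1 Q 0 := by
  intro ε _
  refine ⟨0, fun n _ => ⟨1, 1, by simp, ⟨le_rfl, ?_⟩, Unit, PMF.pure (), fun _ =>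
    ⟨fun _ _ => Classical.arbitrary 𝒳, fun _ => 0, fun _ => 0⟩, fun q _ => ?_⟩⟩
  · simpa using Real.one_le_rpow one_le_two (mul_nonneg n.cast_nonneg hC1)
  · simp [PCode.errIID, PCode.errGiven]

theorem CompRandAchievable.le_cutset {W : 𝒳 → 𝒮 → 𝒴 × 𝒴₁ → ℝ} (hW : IsChannel W) {C1 R : ℝ}
    {Q : Set (𝒮 → ℝ)} (hR : CompRandAchievable W C1 Q R) {q : 𝒮 → ℝ} (hqQ : q ∈ Q)
    (hq : IsPMF q) : R ≤ sSup {v | ∃ p : 𝒳 → ℝ, IsPMF p ∧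
      v = min (IqXY W p q + C1) (IqXYY1 W p q)} := by
  refine le_of_forall_pos_le_add fun δ hδ => ?_
  set K : ℝ := |R| + |R - C1| with hK
  have hK0 : 0 ≤ K := by positivity
  set ε : ℝ := min (1 / 2) (δ / (4 * (K + 1))) with hεdef
  have hε : 0 < ε := by positivity
  obtain ⟨N, hN⟩ := hR ε hε
  obtain ⟨n₀, hn₀⟩ := exists_nat_gt (2 / δ)
  set n := max N (n₀ + 1) with hndef
  obtain ⟨M, L, hMR, hL, J, π, Cs, hCs⟩ := hN n (le_max_left _ _)
  obtain ⟨j, hj⟩ := exists_le_two_mul_of_tsum_le π _ hε (hCs q hqQ)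
  have hn : 0 < n := lt_of_lt_of_le (Nat.succ_pos n₀) (le_max_right _ _)
  have hmain := (Cs j).rate_le_cutset hW hq hn hMR hL hj
    (by linarith [min_le_left (1 / 2 : ℝ) (δ / (4 * (K + 1)))])
  have hinv : (n : ℝ)⁻¹ ≤ δ / 2 := by
    have hnn₀ : (n₀ : ℝ) ≤ n := by exact_mod_cast (Nat.le_succ n₀).trans (le_max_right N _)
    rw [← inv_div]
    exact inv_anti₀ (by positivity) (hn₀.le.trans hnn₀)
  have hεK : 2 * ε * K ≤ δ / 2 := by
    have h1 : ε ≤ δ / (4 * (K + 1)) := min_le_right _ _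
    rw [le_div_iff₀ (by positivity)] at h1
    nlinarith
  linarith

end Relay

/-- The random code capacity of the compound primitive relay channel with state set
`Q` is at most the cutset bound `R_CS(Q)`. -/
theorem compound_randomCapacity_le_cutset
    {𝒳 𝒮 𝒴 𝒴₁ : Type} [Fintype 𝒳] [Fintype 𝒮] [Fintype 𝒴] [Fintype 𝒴₁] [Nonempty 𝒳]
    (W : 𝒳 → 𝒮 → 𝒴 × 𝒴₁ → ℝ) (hW : IsChannel W)
    (C1 : ℝ) (hC1 : 0 ≤ C1)
    (Q : Set (𝒮 → ℝ)) (hQ : ∀ q ∈ Q, IsPMF q) (hQne : Q.Nonempty) :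
    CompRandCapacity W C1 Q ≤ RCS W C1 Q := by
  refine csSup_le ⟨0, compRandAchievable_zero W hC1 Q⟩ fun R hR => le_csInf ?_ ?_
  · obtain ⟨q, hq⟩ := hQne
    exact ⟨_, q, hq, rfl⟩
  · rintro _ ⟨q, hq, rfl⟩
    exact hR.le_cutset hW hq (hQ q hq)
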